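/- There is no sequence (A_n)_{n∈ℕ} of reals such that, for each n, the hyperjump of A_{n+1} is hyperarithmetically reducible to A_n, i.e., 𝒪^{A_{n+1}} ≤_H A_n for all n. -/

import Mathlib

open FirstOrder FirstOrder.Language

namespace HyperdegreeFormalization

/-- Function symbols: `0`, successor, `+`, `·`, and a unary symbol standing for a
function variable (the function quantified in `Σ¹₁`/`Π¹₁` normal forms). -/
inductive Func : ℕ → Type
  | zero : Func 0
  | succ : Func 1
  | fn : Func 1
  | add : Func 2
  | mul : Func 2

/-- Relation symbols: a unary predicate symbol standing for the real (set) parameter,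
and `≤`. -/
inductive Rel : ℕ → Type
  | mem : Rel 1
  | le : Rel 2

/-- The language of arithmetic augmented by a set parameter and a function variable. -/
def L : Language := ⟨Func, Rel⟩

/-- The standard model `ℕ`, interpreting the set parameter as `B` and the function
variable as `f`. -/
def str (B : Set ℕ) (f : ℕ → ℕ) : L.Structure ℕ where
  funMap {n} F v :=
    match F with
    | .zero => 0
    | .succ => v 0 + 1
    | .fn => f (v 0)
    | .add => v 0 + v 1
    | .mul => v 0 * v 1
  RelMap {n} r v :=
    match r with
    | .mem => v 0 ∈ B
    | .le => v 0 ≤ v 1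

/-- Realization of a formula with one free number variable at `n`, in the standard
model with set parameter `B` and function parameter `f`. -/
def Realizes (B : Set ℕ) (f : ℕ → ℕ) (φ : L.Formula (Fin 1)) (n : ℕ) : Prop :=
  letI := str B f
  φ.Realize ![n]

/-- `A` is `Σ¹₁` in `B`: membership of `n` in `A` is equivalent to
`∃f φ(n, f, B)` with `φ` arithmetic (first-order in the displayed parameters). -/
def Sigma11In (B A : Set ℕ) : Prop :=
  ∃ φ : L.Formula (Fin 1), ∀ n, n ∈ A ↔ ∃ f : ℕ → ℕ, Realizes B f φ n

/-- `C` is `Π¹₁` in `B`. -/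
def Pi11In (B C : Set ℕ) : Prop := Sigma11In B Cᶜ

/-- `A ≤_H B`: `A` is hyperarithmetical in `B`, i.e. (by Kleene's theorem
`HYP(B) = Δ¹₁(B)`) both `A` and its complement are `Σ¹₁` in `B`. -/
def HypLE (A B : Set ℕ) : Prop := Sigma11In B A ∧ Sigma11In B Aᶜ

/-- `J` is (a copy of) the hyperjump `𝒪^A` of `A`: a `Π¹₁(A)` set of natural numbers
which is complete for `Π¹₁(A)` sets with respect to many-one reducibility
(Kleene's `𝒪` relativized to `A` is such a set). -/
def IsHyperjump (A J : Set ℕ) : Prop :=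
  Pi11In A J ∧ ∀ C : Set ℕ, Pi11In A C → ManyOneReducible (· ∈ C) (· ∈ J)

/-- Uniform first-order definability. -/
def D (B : Set ℕ) (P : (ℕ → ℕ) → (ℕ → ℕ) → Prop) : Prop :=
  ∃ φ : L.Formula ℕ, ∀ f v, (@Formula.Realize L ℕ (str B f) ℕ φ v) ↔ P f v

variable {B : Set ℕ}

theorem D.congr {P Q : (ℕ → ℕ) → (ℕ → ℕ) → Prop} (h : D B P) (e : ∀ f v, P f v ↔ Q f v) : D B Q := by
  obtain ⟨φ, hφ⟩ := h
  exact ⟨φ, fun f v => (hφ f v).trans (e f v)⟩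

theorem D.not {P : (ℕ → ℕ) → (ℕ → ℕ) → Prop} (h : D B P) : D B (fun f v => ¬ P f v) := by
  obtain ⟨φ, hφ⟩ := h
  refine ⟨φ.not, fun f v => ?_⟩
  let _ := str B f
  exact Formula.realize_not.trans (not_congr (hφ f v))

theorem D.imp {P Q : (ℕ → ℕ) → (ℕ → ℕ) → Prop} (h : D B P) (h' : D B Q) :
    D B (fun f v => P f v → Q f v) := by
  obtain ⟨φ, hφ⟩ := h
  obtain ⟨ψ, hψ⟩ := h'
  refine ⟨φ.imp ψ, fun f v => ?_⟩
  let _ := str B f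
  exact Formula.realize_imp.trans (imp_congr (hφ f v) (hψ f v))

theorem D.and {P Q : (ℕ → ℕ) → (ℕ → ℕ) → Prop} (h : D B P) (h' : D B Q) :
    D B (fun f v => P f v ∧ Q f v) :=
  (h.imp h'.not).not.congr fun f v => by tauto

theorem D.or {P Q : (ℕ → ℕ) → (ℕ → ℕ) → Prop} (h : D B P) (h' : D B Q) :
    D B (fun f v => P f v ∨ Q f v) :=
  (h.not.imp h').congr fun f v => by tauto

theorem D.map {P : (ℕ → ℕ) → (ℕ → ℕ) → Prop} (h : D B P) (σ : ℕ → ℕ) :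
    D B (fun f v => P f (fun i => v (σ i))) := by
  obtain ⟨φ, hφ⟩ := h
  refine ⟨φ.relabel σ, fun f v => ?_⟩
  let _ := str B f
  exact Formula.realize_relabel.trans (hφ f _)

theorem D.ex {P : (ℕ → ℕ) → ℕ → (ℕ → ℕ) → Prop}
    (h : D B (fun f v => P f (v 0) (fun i => v (i + 1)))) : D B (fun f v => ∃ n, P f n v) := by
  obtain ⟨φ, hφ⟩ := h
  refine ⟨(φ.relabel (fun i => Nat.casesOn i (Sum.inr ()) Sum.inl : ℕ → ℕ ⊕ Unit)).iExs Unit,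
    fun f v => ?_⟩
  let _ := str B f
  refine (Formula.realize_iExs).trans ?_
  have : ∀ i : Unit → ℕ, Formula.Realize (φ.relabel (fun i => Nat.casesOn i (Sum.inr ()) Sum.inl : ℕ → ℕ ⊕ Unit)) (fun a => Sum.elim v i a) ↔ P f (i ()) v := by
    intro i
    refine Formula.realize_relabel.trans ?_
    exact (hφ f _)
  constructor
  · rintro ⟨i, hi⟩
    exact ⟨i (), (this i).1 hi⟩
  · rintro ⟨n, hn⟩
    exact ⟨fun _ => n, (this _).2 hn⟩

theorem D.all {P : (ℕ → ℕ) → ℕ → (ℕ → ℕ) → Prop}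
    (h : D B (fun f v => P f (v 0) (fun i => v (i + 1)))) : D B (fun f v => ∀ n, P f n v) :=
  (D.ex (P := fun f n v => ¬ P f n v) h.not).not.congr fun f v => by simp

/-- Definable functions. -/
def DF (B : Set ℕ) (t : (ℕ → ℕ) → (ℕ → ℕ) → ℕ) : Prop :=
  D B (fun f v => v 0 = t f (fun i => v (i + 1)))

theorem D.sub {P : (ℕ → ℕ) → ℕ → (ℕ → ℕ) → Prop} {t : (ℕ → ℕ) → (ℕ → ℕ) → ℕ}
    (ht : DF B t) (h : D B (fun f v => P f (v 0) (fun i => v (i + 1)))) :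
    D B (fun f v => P f (t f v) v) :=
  (D.ex (P := fun f n v => n = t f v ∧ P f n v) (D.and ht h)).congr fun f v => by simp

theorem DF.map {t : (ℕ → ℕ) → (ℕ → ℕ) → ℕ} (h : DF B t) (σ : ℕ → ℕ) :
    DF B (fun f v => t f (fun i => v (σ i))) :=
  D.map (P := fun f v => v 0 = t f (fun i => v (i + 1))) h
    (fun i => Nat.casesOn (motive := fun _ => ℕ) i 0 (fun i => σ i + 1))

theorem eq0 (i j : ℕ) : D B (fun _ v => v i = v j) := by
  refine ⟨Term.equal (L := L) (Term.var i) (Term.var j), fun f v => ?_⟩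
  let _ := str B f
  exact Formula.realize_equal

theorem le0 (i j : ℕ) : D B (fun _ v => v i ≤ v j) := by
  refine ⟨Relations.formula (L := L) (n := 2) Rel.le ![Term.var i, Term.var j], fun f v => ?_⟩
  let _ := str B f
  exact Formula.realize_rel

theorem mem0 (i : ℕ) : D B (fun _ v => v i ∈ B) := by
  refine ⟨Relations.formula (L := L) (n := 1) Rel.mem ![Term.var i], fun f v => ?_⟩
  let _ := str B f
  exact Formula.realize_rel

theorem D.term (s : L.Term ℕ) (i : ℕ) :
    D B (fun f v => v i = @Term.realize L ℕ (str B f) ℕ v s) := by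
  refine ⟨Term.equal (L := L) (Term.var i) s, fun f v => ?_⟩
  let _ := str B f
  exact Formula.realize_equal

theorem DF.var (i : ℕ) : DF B (fun _ v => v i) := eq0 0 (i + 1)

theorem zero0 : D B (fun _ v => v 0 = 0) :=
  D.term (Term.func (L := L) (l := 0) Func.zero ![]) 0
theorem succ0 : D B (fun _ v => v 0 = v 1 + 1) :=
  D.term (Term.func (L := L) (l := 1) Func.succ ![Term.var 1]) 0
theorem fn0 : D B (fun f v => v 0 = f (v 1)) :=
  D.term (Term.func (L := L) (l := 1) Func.fn ![Term.var 1]) 0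
theorem add0 : D B (fun _ v => v 0 = v 1 + v 2) :=
  D.term (Term.func (L := L) (l := 2) Func.add ![Term.var 1, Term.var 2]) 0
theorem mul0 : D B (fun _ v => v 0 = v 1 * v 2) :=
  D.term (Term.func (L := L) (l := 2) Func.mul ![Term.var 1, Term.var 2]) 0

theorem D.comp1 {P : (ℕ → ℕ) → ℕ → Prop} (h : D B (fun f v => P f (v 0)))
    {s} (hs : DF B s) : D B (fun f v => P f (s f v)) :=
  D.sub (P := fun f n _ => P f n) hs h

theorem D.comp2 {P : (ℕ → ℕ) → ℕ → ℕ → Prop} (h : D B (fun f v => P f (v 0) (v 1)))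
    {s t} (hs : DF B s) (ht : DF B t) : D B (fun f v => P f (s f v) (t f v)) := by
  refine D.sub (P := fun f n v => P f n (t f v)) hs ?_
  refine D.sub (P := fun f n v => P f (v 0) n) (t := fun f v => t f (fun i => v (i+1))) (ht.map _) ?_
  exact h.map (fun i => Nat.casesOn i 1 (fun _ => 0))

theorem D.comp3 {P : (ℕ → ℕ) → ℕ → ℕ → ℕ → Prop} (h : D B (fun f v => P f (v 0) (v 1) (v 2)))
    {s t u} (hs : DF B s) (ht : DF B t) (hu : DF B u) : D B (fun f v => P f (s f v) (t f v) (u f v)) := by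
  refine D.sub (P := fun f n v => P f n (t f v) (u f v)) hs ?_
  refine D.sub (P := fun f n v => P f (v 0) n (u f (fun i => v (i + 1))))
    (t := fun f v => t f (fun i => v (i+1))) (ht.map _) ?_
  refine D.sub (P := fun f n v => P f (v 1) (v 0) n)
    (t := fun f v => u f (fun i => v (i+1+1))) (hu.map _) ?_
  exact h.map (fun i => 2 - i)

theorem DF.comp1 {g : (ℕ → ℕ) → ℕ → ℕ} (h : D B (fun f v => v 0 = g f (v 1)))
    {s} (hs : DF B s) : DF B (fun f v => g f (s f v)) :=
  D.comp2 (P := fun f a b => a = g f b) h (DF.var 0) (hs.map _)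

theorem DF.comp2 {g : (ℕ → ℕ) → ℕ → ℕ → ℕ} (h : D B (fun f v => v 0 = g f (v 1) (v 2)))
    {s t} (hs : DF B s) (ht : DF B t) : DF B (fun f v => g f (s f v) (t f v)) :=
  D.comp3 (P := fun f a b c => a = g f b c) h (DF.var 0) (hs.map _) (ht.map _)

theorem D.eq {s t} (hs : DF B s) (ht : DF B t) : D B (fun f v => s f v = t f v) :=
  D.comp2 (P := fun _ a b => a = b) (eq0 0 1) hs ht
theorem D.le {s t} (hs : DF B s) (ht : DF B t) : D B (fun f v => s f v ≤ t f v) :=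
  D.comp2 (P := fun _ a b => a ≤ b) (le0 0 1) hs ht
theorem D.lt {s t} (hs : DF B s) (ht : DF B t) : D B (fun f v => s f v < t f v) :=
  (D.le ht hs).not.congr fun f v => by simp
theorem DF.zero : DF B (fun _ _ => 0) := zero0
theorem DF.succ {s} (hs : DF B s) : DF B (fun f v => s f v + 1) :=
  DF.comp1 (g := fun _ a => a + 1) succ0 hs
theorem DF.fn {s} (hs : DF B s) : DF B (fun f v => f (s f v)) :=
  DF.comp1 (g := fun f a => f a) fn0 hs
theorem DF.add {s t} (hs : DF B s) (ht : DF B t) : DF B (fun f v => s f v + t f v) :=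
  DF.comp2 (g := fun _ a b => a + b) add0 hs ht
theorem DF.mul {s t} (hs : DF B s) (ht : DF B t) : DF B (fun f v => s f v * t f v) :=
  DF.comp2 (g := fun _ a b => a * b) mul0 hs ht

theorem DF.pair {s t} (hs : DF B s) (ht : DF B t) : DF B (fun f v => Nat.pair (s f v) (t f v)) := by
  refine DF.comp2 (g := fun _ a b => Nat.pair a b) ?_ hs ht
  refine D.congr (P := fun _ v => (v 1 < v 2 ∧ v 0 = v 2 * v 2 + v 1) ∨
    (¬ v 1 < v 2 ∧ v 0 = v 1 * v 1 + v 1 + v 2)) ?_ ?_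
  · exact ((D.lt (.var 1) (.var 2)).and (D.eq (.var 0) (((DF.var 2).mul (.var 2)).add (.var 1)))).or
      ((D.lt (.var 1) (.var 2)).not.and
        (D.eq (.var 0) ((((DF.var 1).mul (.var 1)).add (.var 1)).add (.var 2))))
  · intro f v
    unfold Nat.pair
    split_ifs <;> simp [*]

theorem DF.fst {s} (hs : DF B s) : DF B (fun f v => (s f v).unpair.1) := by
  refine DF.comp1 (g := fun _ a => a.unpair.1) ?_ hs
  refine D.congr (P := fun _ v => ∃ b, v 1 = Nat.pair (v 0) b) ?_ ?_
  · exact D.ex (P := fun _ b v => v 1 = Nat.pair (v 0) b) (D.eq (.var 2) ((DF.var 1).pair (.var 0)))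
  · intro f v
    constructor
    · rintro ⟨b, hb⟩; simp [hb]
    · intro h; exact ⟨(v 1).unpair.2, by simp [h]⟩

theorem DF.snd {s} (hs : DF B s) : DF B (fun f v => (s f v).unpair.2) := by
  refine DF.comp1 (g := fun _ a => a.unpair.2) ?_ hs
  refine D.congr (P := fun _ v => ∃ b, v 1 = Nat.pair b (v 0)) ?_ ?_
  · exact D.ex (P := fun _ b v => v 1 = Nat.pair b (v 0)) (D.eq (.var 2) ((DF.var 0).pair (.var 1)))
  · intro f v
    constructor
    · rintro ⟨b, hb⟩; simp [hb]
    · intro h; exact ⟨(v 1).unpair.1, by simp [h]⟩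

theorem DF.modS {s t} (hs : DF B s) (ht : DF B t) : DF B (fun f v => s f v % (t f v + 1)) := by
  refine DF.comp2 (g := fun _ a b => a % (b + 1)) ?_ hs ht
  refine D.congr (P := fun _ v => ∃ q, v 1 = (v 2 + 1) * q + v 0 ∧ v 0 < v 2 + 1) ?_ ?_
  · exact D.ex (P := fun _ q v => v 1 = (v 2 + 1) * q + v 0 ∧ v 0 < v 2 + 1)
      ((D.eq (.var 2) (((DF.var 3).succ.mul (.var 0)).add (.var 1))).and
        (D.lt (.var 1) (DF.var 3).succ))
  · intro f v
    constructor
    · rintro ⟨b, hb, hl⟩; rw [hb, Nat.mul_add_mod, Nat.mod_eq_of_lt hl]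
    · intro h
      rw [h]
      exact ⟨v 1 / (v 2 + 1), (Nat.div_add_mod _ _).symm, Nat.mod_lt _ (by omega)⟩

theorem DF.beta {s t} (hs : DF B s) (ht : DF B t) : DF B (fun f v => Nat.beta (s f v) (t f v)) :=
  DF.modS hs.fst (ht.succ.mul hs.snd)

theorem exists_beta (g : ℕ → ℕ) (n : ℕ) : ∃ c, ∀ i ≤ n, Nat.beta c i = g i := by
  refine ⟨Nat.unbeta ((List.range (n + 1)).map g), fun i hi => ?_⟩
  have := Nat.beta_unbeta_coe ((List.range (n + 1)).map g) ⟨i, by simp; omega⟩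
  simpa using this

theorem prec_iff (f g : ℕ →. ℕ) (a n z : ℕ) :
    z ∈ (Nat.rec (f a) (fun y IH => do let i ← IH; g (Nat.pair a (Nat.pair y i))) n : Part ℕ) ↔
    ∃ c, Nat.beta c 0 ∈ f a ∧
      (∀ y, y < n → Nat.beta c (y + 1) ∈ g (Nat.pair a (Nat.pair y (Nat.beta c y)))) ∧
      z = Nat.beta c n := by
  constructor
  · intro h
    have key : ∃ s : ℕ → ℕ, s 0 ∈ f a ∧ (∀ y, y < n → s (y + 1) ∈ g (Nat.pair a (Nat.pair y (s y)))) ∧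
      z = s n := by
      induction n generalizing z with
      | zero => exact ⟨fun _ => z, h, by simp, rfl⟩
      | succ n ih =>
        obtain ⟨i, hi, hz⟩ := Part.mem_bind_iff.1 h
        obtain ⟨s, h0, h1, h2⟩ := ih i hi
        refine ⟨fun m => if m ≤ n then s m else z, by simpa using h0, ?_, by simp⟩
        intro y hy
        rcases Nat.lt_or_ge y n with hl | hl
        · have := h1 y hl
          simpa [hl.le, Nat.succ_le_of_lt hl] using this
        · have : y = n := by omega
          subst this
          simpa [← h2] using hz
    obtain ⟨s, h0, h1, h2⟩ := key
    obtain ⟨c, hc⟩ := exists_beta s n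
    refine ⟨c, by rw [hc 0 (by omega)]; exact h0, fun y hy => ?_, by rw [hc n le_rfl]; exact h2⟩
    rw [hc _ hy, hc _ hy.le]; exact h1 y hy
  · rintro ⟨c, h0, h1, rfl⟩
    induction n with
    | zero => exact h0
    | succ n ih =>
      exact Part.mem_bind_iff.2 ⟨_, ih fun y hy => h1 y (by omega), h1 n (by omega)⟩

theorem DPart {g : ℕ →. ℕ} (hg : Nat.Partrec g) : D B (fun _ v => v 0 ∈ g (v 1)) := by
  induction hg with
  | zero => exact (D.eq (.var 0) .zero).congr fun f v => by simp [pure, PFun.pure]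
  | succ => exact (D.eq (.var 0) (DF.var 1).succ).congr fun f v => by simp
  | left => exact (D.eq (.var 0) (DF.var 1).fst).congr fun f v => by simp
  | right => exact (D.eq (.var 0) (DF.var 1).snd).congr fun f v => by simp
  | @pair f g _ _ hf hg =>
    have h1 : D B (fun _ v => (v 0).unpair.1 ∈ f (v 1)) :=
      D.comp2 (P := fun _ a b => a ∈ f b) hf (DF.var 0).fst (.var 1)
    have h2 : D B (fun _ v => (v 0).unpair.2 ∈ g (v 1)) :=
      D.comp2 (P := fun _ a b => a ∈ g b) hg (DF.var 0).snd (.var 1)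
    refine (h1.and h2).congr fun _ v => ?_
    simp only [Seq.seq, Part.mem_bind_iff, Part.map_eq_map, Part.mem_map_iff]
    constructor
    · rintro ⟨h, h'⟩
      exact ⟨_, ⟨_, h, rfl⟩, _, h', by simp⟩
    · rintro ⟨_, ⟨a, h, rfl⟩, b, h', e⟩
      simp only [← e, Nat.unpair_pair]; exact ⟨h, h'⟩
  | @comp f g _ _ hf hg =>
    refine D.congr (P := fun _ v => ∃ y, y ∈ g (v 1) ∧ v 0 ∈ f y) ?_ ?_
    · exact D.ex (P := fun _ y v => y ∈ g (v 1) ∧ v 0 ∈ f y)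
        ((D.comp2 (P := fun _ a b => a ∈ g b) hg (.var 0) (.var 2)).and
          (D.comp2 (P := fun _ a b => a ∈ f b) hf (.var 1) (.var 0)))
    · intro _ v; exact Part.mem_bind_iff.symm
  | @prec f g _ _ hf hg =>
    refine D.congr (P := fun _ v => ∃ c, Nat.beta c 0 ∈ f (v 1).unpair.1 ∧
      (∀ y, y < (v 1).unpair.2 →
        Nat.beta c (y + 1) ∈ g (Nat.pair (v 1).unpair.1 (Nat.pair y (Nat.beta c y)))) ∧
      v 0 = Nat.beta c (v 1).unpair.2) ?_ (fun _ v => (prec_iff f g _ _ _).symm)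
    refine D.ex (D.and ?_ (D.and (D.all (D.imp ?_ ?_)) ?_))
    · exact D.comp2 (P := fun _ a b => a ∈ f b) hf ((DF.var 0).beta .zero) (DF.var 2).fst
    · exact D.lt (.var 0) (DF.var 3).snd
    · exact D.comp2 (P := fun _ a b => a ∈ g b) hg ((DF.var 1).beta (DF.var 0).succ)
        ((DF.var 3).fst.pair ((DF.var 0).pair ((DF.var 1).beta (.var 0))))
    · exact D.eq (.var 1) ((DF.var 0).beta (DF.var 2).snd)
  | @rfind f _ hf =>
    refine D.congr (P := fun _ v => 0 ∈ f (Nat.pair (v 1) (v 0)) ∧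
      ∀ m, m < v 0 → ∃ k, k + 1 ∈ f (Nat.pair (v 1) m)) ?_ ?_
    · refine D.and ?_ (D.all (D.imp ?_ (D.ex ?_)))
      · exact D.comp2 (P := fun _ a b => a ∈ f b) hf .zero ((DF.var 1).pair (.var 0))
      · exact D.lt (.var 0) (.var 1)
      · exact D.comp2 (P := fun _ a b => a ∈ f b) hf (DF.var 0).succ ((DF.var 3).pair (.var 1))
    · intro _ v
      refine Iff.trans ?_ Nat.mem_rfind.symm
      simp only [Part.map_eq_map, Part.mem_map_iff]
      refine and_congr ?_ (forall_congr' fun m => imp_congr_right fun _ => ?_)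
      · simp
      · constructor
        · rintro ⟨k, hk⟩; exact ⟨_, hk, by simp⟩
        · rintro ⟨k, hk, h⟩
          obtain ⟨k, rfl⟩ := Nat.exists_eq_succ_of_ne_zero (n := k) (by simpa using h)
          exact ⟨k, hk⟩

theorem DF.sub {H : (ℕ → ℕ) → ℕ → (ℕ → ℕ) → ℕ} {s : (ℕ → ℕ) → (ℕ → ℕ) → ℕ}
    (hH : DF B (fun f v => H f (v 0) (fun i => v (i + 1)))) (hs : DF B s) :
    DF B (fun f v => H f (s f v) v) := by
  refine D.sub (P := fun f n v => v 0 = H f n (fun i => v (i + 1)))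
    (t := fun f v => s f (fun i => v (i + 1))) (hs.map _) ?_
  exact D.map (P := fun f v => v 0 = H f (v 1) (fun i => v (i + 1 + 1))) hH
    (fun i => Nat.casesOn (motive := fun _ => ℕ) i 1
      (fun i => Nat.casesOn (motive := fun _ => ℕ) i 0 (fun i => i + 2)))

theorem DF.realize {α : Type} (s : L.Term α) (G : (ℕ → ℕ) → (ℕ → ℕ) → ℕ → ℕ)
    (hG : DF B (fun f v => G f (fun i => v (i + 1)) (v 0)))
    (a : α → (ℕ → ℕ) → (ℕ → ℕ) → ℕ) (ha : ∀ i, DF B (a i)) :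
    DF B (fun f v => @Term.realize L ℕ (str B (G f v)) α (fun i => a i f v) s) := by
  induction s with
  | var i => exact ha i
  | func F ts ih =>
    cases F with
    | zero => exact DF.zero
    | succ => exact (ih 0).succ
    | fn => exact DF.sub (H := fun f n v => G f v n) hG (ih 0)
    | add => exact (ih 0).add (ih 1)
    | mul => exact (ih 0).mul (ih 1)

theorem D.realize {n : ℕ} (φ : L.BoundedFormula ℕ n) : ∀ (G : (ℕ → ℕ) → (ℕ → ℕ) → ℕ → ℕ)
    (_ : DF B (fun f v => G f (fun i => v (i + 1)) (v 0)))
    (a : ℕ → (ℕ → ℕ) → (ℕ → ℕ) → ℕ) (_ : ∀ i, DF B (a i))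
    (x : Fin n → (ℕ → ℕ) → (ℕ → ℕ) → ℕ) (_ : ∀ i, DF B (x i)),
    D B (fun f v => @BoundedFormula.Realize L ℕ (str B (G f v)) ℕ n φ
      (fun i => a i f v) (fun i => x i f v)) := by
  have hT : ∀ (n : ℕ) (s : L.Term (ℕ ⊕ Fin n)) (G : (ℕ → ℕ) → (ℕ → ℕ) → ℕ → ℕ)
    (_ : DF B (fun f v => G f (fun i => v (i + 1)) (v 0)))
    (a : ℕ → (ℕ → ℕ) → (ℕ → ℕ) → ℕ) (_ : ∀ i, DF B (a i))
    (x : Fin n → (ℕ → ℕ) → (ℕ → ℕ) → ℕ) (_ : ∀ i, DF B (x i)),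
    DF B (fun f v => @Term.realize L ℕ (str B (G f v)) _
      (Sum.elim (fun i => a i f v) (fun i => x i f v)) s) := by
    intro n s G hG a ha x hx
    have := DF.realize s G hG (Sum.elim a x) (by rintro (i | i); exacts [ha i, hx i])
    have e : ∀ f v, (fun i => Sum.elim a x i f v) = Sum.elim (fun i => a i f v) (fun i => x i f v) := by
      intro f v; funext i; cases i <;> rfl
    simpa only [e] using this
  induction φ with
  | falsum =>
    intros
    exact (D.lt (.var 0) (.var 0)).congr fun f v => by simp [BoundedFormula.Realize]
  | equal s t =>
    intro G hG a ha x hx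
    exact D.eq (hT _ s G hG a ha x hx) (hT _ t G hG a ha x hx)
  | rel R ts =>
    intro G hG a ha x hx
    cases R with
    | mem => exact D.comp1 (P := fun _ y => y ∈ B) (mem0 0) (hT _ (ts 0) G hG a ha x hx)
    | le => exact D.le (hT _ (ts 0) G hG a ha x hx) (hT _ (ts 1) G hG a ha x hx)
  | imp φ ψ h1 h2 =>
    intro G hG a ha x hx
    exact (h1 G hG a ha x hx).imp (h2 G hG a ha x hx)
  | @all n φ ih =>
    intro G hG a ha x hx
    refine D.all (P := fun f m v => @BoundedFormula.Realize L ℕ (str B (G f v)) ℕ _ φ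
      (fun i => a i f v) (Fin.snoc (fun i => x i f v) m)) ?_
    have := ih (fun f v => G f (fun i => v (i + 1)))
      (DF.map hG (fun i => Nat.casesOn (motive := fun _ => ℕ) i 0 (fun i => i + 2)))
      (fun i f v => a i f (fun i => v (i + 1))) (fun i => (ha i).map _)
      (Fin.snoc (α := fun _ => (ℕ → ℕ) → (ℕ → ℕ) → ℕ)
        (fun i f v => x i f (fun i => v (i + 1))) (fun _ v => v 0)) (by
          intro i
          refine Fin.lastCases ?_ (fun i => ?_) i
          · simpa using DF.var 0
          · simpa using (hx i).map _)
    refine this.congr fun f v => ?_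
    have e : (fun i => Fin.snoc (α := fun _ => (ℕ → ℕ) → (ℕ → ℕ) → ℕ)
        (fun i f v => x i f (fun i => v (i + 1))) (fun _ v => v 0) i f v) =
        (Fin.snoc (α := fun _ => ℕ) (fun i => x i f (fun i => v (i + 1))) (v 0)) := by
      funext i
      refine Fin.lastCases ?_ (fun i => ?_) i <;> simp
    rw [e]

theorem D.slice {Q : (ℕ → ℕ) → (ℕ → ℕ) → Prop} (h : D B Q) :
    D B (fun f v => Q (fun m => f (Nat.pair (v 0) m)) (fun i => v (i + 1))) := by
  obtain ⟨φ, hφ⟩ := h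
  have := D.realize (B := B) φ (fun f v m => f (Nat.pair (v 0) m))
    (((DF.var 1).pair (.var 0)).fn) (fun i _ v => v (i + 1)) (fun i => .var _)
    (fun i => default) (fun i => i.elim0)
  refine this.congr fun f v => ?_
  rw [← hφ]
  unfold Formula.Realize
  exact iff_of_eq (congrArg _ (Subsingleton.elim _ _))

/-- Sigma-1-1 predicates of number environments. -/
def S (B : Set ℕ) (P : (ℕ → ℕ) → Prop) : Prop :=
  ∃ Q, D B Q ∧ ∀ v, P v ↔ ∃ f, Q f v

theorem S.congr {P P' : (ℕ → ℕ) → Prop} (h : S B P) (e : ∀ v, P v ↔ P' v) : S B P' := by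
  obtain ⟨Q, hQ, h⟩ := h
  exact ⟨Q, hQ, fun v => (e v).symm.trans (h v)⟩

theorem S.of {P : (ℕ → ℕ) → Prop} (h : D B (fun _ v => P v)) : S B P :=
  ⟨_, h, fun v => by simp⟩

theorem S.map {P : (ℕ → ℕ) → Prop} (h : S B P) (σ : ℕ → ℕ) : S B (fun v => P (fun i => v (σ i))) := by
  obtain ⟨Q, hQ, h⟩ := h
  exact ⟨_, hQ.map σ, fun v => h _⟩

theorem S.or {P P' : (ℕ → ℕ) → Prop} (h : S B P) (h' : S B P') : S B (fun v => P v ∨ P' v) := by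
  obtain ⟨Q, hQ, h⟩ := h
  obtain ⟨Q', hQ', h'⟩ := h'
  exact ⟨_, hQ.or hQ', fun v => by simp only [h, h', exists_or]⟩

theorem S.and {P P' : (ℕ → ℕ) → Prop} (h : S B P) (h' : S B P') : S B (fun v => P v ∧ P' v) := by
  obtain ⟨Q, hQ, h⟩ := h
  obtain ⟨Q', hQ', h'⟩ := h'
  refine ⟨_, (D.sub (P := fun f n v => Q (fun m => f (Nat.pair n m)) v) .zero hQ.slice).and
    (D.sub (P := fun f n v => Q' (fun m => f (Nat.pair n m)) v) DF.zero.succ hQ'.slice), fun v => ?_⟩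
  refine (and_congr (h v) (h' v)).trans ?_
  constructor
  · rintro ⟨⟨f, hf⟩, g, hg⟩
    exact ⟨fun n => if n.unpair.1 = 0 then f n.unpair.2 else g n.unpair.2, by simpa using hf,
      by simpa using hg⟩
  · rintro ⟨f, hf, hg⟩
    exact ⟨⟨_, hf⟩, _, hg⟩

theorem S.ex {P : ℕ → (ℕ → ℕ) → Prop} (h : S B (fun v => P (v 0) (fun i => v (i + 1)))) :
    S B (fun v => ∃ n, P n v) := by
  obtain ⟨Q, hQ, h⟩ := h
  let c : ℕ → (ℕ → ℕ) → ℕ → ℕ := fun n v i => Nat.casesOn (motive := fun _ => ℕ) i n v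
  refine ⟨fun f v => ∃ n, Q f (c n v), D.ex (P := fun f n v => Q f (c n v)) ?_, fun v => ?_⟩
  · refine hQ.congr fun f v => ?_
    have : c (v 0) (fun i => v (i + 1)) = v := by funext i; cases i <;> rfl
    rw [this]
  · rw [exists_comm]
    exact exists_congr fun n => h (c n v)

theorem S.iff {C : Set ℕ} : Sigma11In B C ↔ S B (fun v => v 0 ∈ C) := by
  constructor
  · rintro ⟨φ, h⟩
    refine ⟨fun f v => Realizes B f φ (v 0), ⟨φ.relabel (fun _ => 0), fun f v => ?_⟩, fun v => h _⟩
    let _ := str B f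
    refine Formula.realize_relabel.trans ?_
    have : v ∘ (fun _ : Fin 1 => 0) = ![v 0] := by funext i; fin_cases i; rfl
    rw [this]; rfl
  · rintro ⟨Q, ⟨φ, hφ⟩, h⟩
    refine ⟨φ.relabel (fun _ => 0), fun n => ?_⟩
    refine (h (fun _ => n)).trans ?_
    refine exists_congr fun f => ?_
    let _ := str B f
    rw [← hφ]
    exact (Formula.realize_relabel (g := fun _ => (0 : Fin 1)) (v := ![n])).symm

/-- three element environment -/
def E3 (a b c : ℕ) : ℕ → ℕ
  | 0 => a
  | 1 => b
  | _ => c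

theorem E3_map (v : ℕ → ℕ) (a b c : ℕ) : E3 (v a) (v b) (v c) = fun i => v (E3 a b c i) := by
  funext i
  match i with
  | 0 => rfl
  | 1 => rfl
  | _ + 2 => rfl

theorem S.chain {R : ℕ → ℕ → ℕ → Prop} (h : S B (fun v => R (v 0) (v 1) (v 2))) :
    S B (fun v => ∃ f : ℕ → ℕ, ∀ n, R (v 0) (f (n + 1)) (f n)) := by
  obtain ⟨Q, hQ, h⟩ := h
  refine ⟨fun F v => ∀ n x y k, x = F (Nat.pair 0 (n + 1)) → y = F (Nat.pair 0 n) → k = n + 1 →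
    Q (fun m => F (Nat.pair k m)) (E3 (v 0) x y), ?_, fun v => ?_⟩
  · refine D.all (D.all (D.all (D.all (D.imp ?_ (D.imp ?_ (D.imp ?_ ?_))))))
    · exact D.eq (.var 2) (DF.zero.pair (DF.var 3).succ).fn
    · exact D.eq (.var 1) (DF.zero.pair (DF.var 3)).fn
    · exact D.eq (.var 0) (DF.var 3).succ
    · refine (hQ.slice.map
        (fun i => Nat.casesOn (motive := fun _ => ℕ) i 0 (E3 4 2 1))).congr fun f v => ?_
      show Q _ (fun i => v (E3 4 2 1 i)) ↔ _
      rw [← E3_map]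
      exact Iff.rfl
  · have h' : ∀ a b c, R a b c ↔ ∃ f, Q f (E3 a b c) := fun a b c => h (E3 a b c)
    constructor
    · rintro ⟨f, hf⟩
      have : ∀ n, ∃ g, Q g (E3 (v 0) (f (n + 1)) (f n)) := fun n => (h' _ _ _).1 (hf n)
      choose g hg using this
      refine ⟨fun p => if p.unpair.1 = 0 then f p.unpair.2 else g (p.unpair.1 - 1) p.unpair.2, ?_⟩
      rintro n x y k rfl rfl rfl
      simpa using hg n
    · rintro ⟨F, hF⟩
      exact ⟨fun n => F (Nat.pair 0 n), fun n => (h' _ _ _).2 ⟨_, hF n _ _ _ rfl rfl rfl⟩⟩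

/-- Ranks of well-founded Sigma-1-1 relations. -/
def K (B : Set ℕ) : Set Ordinal.{0} :=
  {o | ∃ C, Sigma11In B C ∧ ∃ h : WellFounded (fun x y => Nat.pair x y ∈ C), ∃ a,
    o = (h.apply a).rank}

open Nat.Partrec (Code)

/-- The relation with index `e`. -/
def U (J : Set ℕ) (e x y : ℕ) : Prop :=
  ∃ z, z ∈ Code.eval (Denumerable.ofNat Code e) (Nat.pair x y) ∧ z ∉ J

theorem S.U {J : Set ℕ} (h : Sigma11In B Jᶜ) : S B (fun v => U J (v 0) (v 1) (v 2)) := by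
  have hp : Nat.Partrec (fun n => Code.eval (Denumerable.ofNat Code n.unpair.1) n.unpair.2) :=
    Partrec.nat_iff.1 (Code.eval_part.comp
      ((Computable.ofNat Code).comp (Computable.fst.comp Computable.unpair))
      (Computable.snd.comp Computable.unpair))
  refine S.ex (S.and (S.of ?_) ((S.iff.1 h).map (fun _ => 0)))
  refine (D.comp2 (P := fun _ a n => a ∈ Code.eval (Denumerable.ofNat Code n.unpair.1) n.unpair.2)
    (DPart hp) (.var 0) ((DF.var 1).pair ((DF.var 2).pair (.var 3)))).congr fun f v => ?_
  simp

theorem U_univ {A J C : Set ℕ} (hJ : IsHyperjump A J) (hC : Sigma11In A C) :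
    ∃ e, ∀ x y, U J e x y ↔ Nat.pair x y ∈ C := by
  obtain ⟨g, hg, hgC⟩ := hJ.2 Cᶜ (by simpa [Pi11In] using hC)
  obtain ⟨c, hc⟩ := Code.exists_code.1 (Partrec.nat_iff.1 hg.partrec)
  refine ⟨Encodable.encode c, fun x y => ?_⟩
  have := hgC (Nat.pair x y)
  simp only [Set.mem_compl_iff] at this
  simp [U, hc, ← this]

theorem reduce {A J C : Set ℕ} (h : ManyOneReducible (· ∈ C) (· ∈ J)) (hJ : Sigma11In A J) :
    Sigma11In A C := by
  obtain ⟨g, hg, hgC⟩ := h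
  have hp := Partrec.nat_iff.1 hg.partrec
  rw [S.iff]
  refine (S.ex (P := fun z v => z ∈ (g : ℕ →. ℕ) (v 0) ∧ z ∈ J)
    (S.and (S.of (DPart hp)) ((S.iff.1 hJ).map (fun i => i)))).congr fun v => ?_
  have := hgC (v 0)
  simp only at this
  simp [this]

theorem step {A A' J : Set ℕ} (hJ : IsHyperjump A' J) (hH : HypLE J A) :
    ∃ o ∈ K A, ∀ o' ∈ K A', o' < o := by
  let W : Set ℕ := {e | WellFounded (U J e)}
  have hW' : Pi11In A' W := by
    refine S.iff.2 ((S.chain (S.U hJ.1)).congr fun v => ?_)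
    simp only [W, Set.mem_compl_iff, Set.mem_setOf_eq, wellFounded_iff_isEmpty_descending_chain]
    simp
  have hW : Sigma11In A W := reduce (hJ.2 W hW') hH.1
  let T : ℕ → ℕ → Prop := fun x y => ∃ e a, x = Nat.pair e a + 1 ∧ e ∈ W ∧
    (y = 0 ∨ ∃ b, y = Nat.pair e b + 1 ∧ U J e a b)
  let C : Set ℕ := {p | T p.unpair.1 p.unpair.2}
  have hC : Sigma11In A C := by
    refine S.iff.2 (S.ex (S.ex (S.and (S.of ?_) (S.and ?_ (S.or (S.of ?_) (S.ex (S.and (S.of ?_) ?_)))))))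
    · exact D.eq (DF.var 2).fst ((DF.var 1).pair (.var 0)).succ
    · exact (S.iff.1 hW).map (fun _ => 1)
    · exact D.eq (DF.var 2).snd .zero
    · exact D.eq (DF.var 3).snd ((DF.var 2).pair (.var 0)).succ
    · exact (S.U hH.2).map (E3 2 1 0)
  have hCT : (fun x y => Nat.pair x y ∈ C) = T := by
    funext x y; simp [C]
  have acc1 : ∀ e ∈ W, ∀ a, Acc T (Nat.pair e a + 1) := by
    intro e he a
    induction a using WellFounded.induction (show WellFounded (U J e) from he) with
    | _ a ih =>
      refine ⟨_, ?_⟩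
      rintro x ⟨e', a', rfl, he', h | ⟨b, hb, hU⟩⟩
      · omega
      · have := Nat.pair_eq_pair.1 (Nat.succ_injective hb)
        obtain ⟨rfl, rfl⟩ := this
        exact ih _ hU
  have hT : WellFounded T := by
    refine ⟨fun y => ⟨_, ?_⟩⟩
    rintro x ⟨e, a, rfl, he, -⟩
    exact acc1 e he a
  have hwf : WellFounded (fun x y => Nat.pair x y ∈ C) := hCT ▸ hT
  refine ⟨(hwf.apply 0).rank, ⟨C, hC, hwf, 0, rfl⟩, ?_⟩
  rintro _ ⟨C', hC', hw', a, rfl⟩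
  obtain ⟨e, he⟩ := U_univ hJ hC'
  have heq : U J e = (fun x y => Nat.pair x y ∈ C') := by funext x y; exact propext (he x y)
  have heW : e ∈ W := by show WellFounded (U J e); rw [heq]; exact hw'
  have hle : ∀ a, (hw'.apply a).rank ≤ (hwf.apply (Nat.pair e a + 1)).rank := by
    intro a
    induction a using WellFounded.induction hw' with
    | _ a ih =>
      rw [Acc.rank_eq]
      refine Ordinal.iSup_le ?_
      rintro ⟨b, hb⟩
      refine Order.succ_le_of_lt (lt_of_le_of_lt (ih b hb) ?_)
      refine Acc.rank_lt_of_rel (hwf.apply (Nat.pair e a + 1)) ?_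
      simp only [C, Set.mem_setOf_eq, Nat.unpair_pair]
      exact ⟨e, b, rfl, heW, Or.inr ⟨a, rfl, (he _ _).2 hb⟩⟩
  refine lt_of_le_of_lt (hle a) ?_
  refine Acc.rank_lt_of_rel (hwf.apply 0) ?_
  simp only [C, Set.mem_setOf_eq, Nat.unpair_pair]
  exact ⟨e, a, rfl, heW, Or.inl rfl⟩

/-- Spector.  There is no sequence `(A_n)` of reals such that
`𝒪^(A_(n+1)) ≤_H A_n` for every `n`. -/
theorem statement_13 :
    ¬ ∃ (A J : ℕ → Set ℕ),
      (∀ n, IsHyperjump (A (n + 1)) (J (n + 1))) ∧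
      (∀ n, HypLE (J (n + 1)) (A n)) := by
  rintro ⟨A, J, h1, h2⟩
  choose o ho ho' using fun n => step (h1 n) (h2 n)
  have hlt : ∀ n, o (n + 1) < o n := fun n => ho' n _ (ho (n + 1))
  exact (wellFounded_iff_isEmpty_descending_chain.1
    (wellFounded_lt : WellFounded ((· < ·) : Ordinal.{0} → Ordinal → Prop))).false ⟨o, hlt⟩

end HyperdegreeFormalization
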